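/- Let v = (e0 − iβ·K·e1)·(1 − 2·f⁺·f⁻) ∈ Q, where f⁺ = −iF, f⁻ = EK^{-1}. Then: (i) v is central and invertible, and ε(v) = 1; (ii) S(v) = v; (iii) M·Δ(v) = v⊗v, where M = R₂₁·R is the monodromy matrix and R₂₁ denotes the tensor flip of R; (iv) v = e0 + β·(e1⁺ − e1⁻) + 2i·(w⁺ − w⁻), where e1^± = (1/2 ± C)·e1 with C = FE − (i/4)(K − K^{-1}), and w^± = (1/2)·EF·(1 ± K)·e0. Thus v is a ribbon element for the quasi-triangular quasi-Hopf algebra (Q, Φ, R). -/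

import Mathlib

open TensorProduct

set_option maxHeartbeats 1000000
set_option synthInstance.maxHeartbeats 400000

noncomputable section

/-- Generators of the restricted quantum group `Q = \bar U_i sl(2)`. -/
inductive QGen : Type
  | E | F | K | Kinv
deriving DecidableEq

/-- The free algebra on the generators. -/
abbrev FA : Type := FreeAlgebra ℂ QGen

def ιE : FA := FreeAlgebra.ι ℂ QGen.E
def ιF : FA := FreeAlgebra.ι ℂ QGen.F
def ιK : FA := FreeAlgebra.ι ℂ QGen.K
def ιKi : FA := FreeAlgebra.ι ℂ QGen.Kinv

/-- Defining relations of `\bar U_i sl(2)` (at `q = i`, i.e. `p = 2`). -/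
inductive QRel : FA → FA → Prop
  | KKi : QRel (ιK * ιKi) 1
  | KiK : QRel (ιKi * ιK) 1
  | KEKi : QRel (ιK * ιE * ιKi) (-ιE)
  | KFKi : QRel (ιK * ιF * ιKi) (-ιF)
  | EF : QRel (ιE * ιF - ιF * ιE) ((2 * Complex.I)⁻¹ • (ιK - ιKi))
  | Esq : QRel (ιE ^ 2) 0
  | Fsq : QRel (ιF ^ 2) 0
  | K4 : QRel (ιK ^ 4) 1

/-- The restricted quantum group `\bar U_i sl(2)`: the quotient of the free algebra
by the two-sided ideal generated by the defining relations. -/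
abbrev Q : Type := RingQuot QRel

def gE : Q := RingQuot.mkAlgHom ℂ QRel ιE
def gF : Q := RingQuot.mkAlgHom ℂ QRel ιF
def gK : Q := RingQuot.mkAlgHom ℂ QRel ιK
def gKi : Q := RingQuot.mkAlgHom ℂ QRel ιKi

section Gadgets

variable (k : Type) [Field k] (A : Type) [Ring A] [Algebra k A]

abbrev TP2 : Type := A ⊗[k] A
abbrev TP3 : Type := A ⊗[k] (A ⊗[k] A)
abbrev TP4 : Type := A ⊗[k] (A ⊗[k] (A ⊗[k] A))

/-- Multiplication `a ⊗ b ↦ a * b`. -/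
def mulA : TP2 k A →ₗ[k] A := LinearMap.mul' k A

/-- Tensor flip `a ⊗ b ↦ b ⊗ a`. -/
def flipA : TP2 k A →ₗ[k] TP2 k A := (TensorProduct.comm k A A).toLinearMap

/-- `a ↦ a ⊗ 1`. -/
def lTen : A →ₗ[k] TP2 k A := (TensorProduct.mk k A A).flip 1

/-- `a ↦ 1 ⊗ a`. -/
def rTen : A →ₗ[k] TP2 k A := TensorProduct.mk k A A 1

/-- `a ⊗ b ↦ a ⊗ b ⊗ 1`. -/
def emb12 : TP2 k A →ₗ[k] TP3 k A := TensorProduct.map LinearMap.id (lTen k A)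

/-- `a ⊗ b ↦ a ⊗ 1 ⊗ b`. -/
def emb13 : TP2 k A →ₗ[k] TP3 k A := TensorProduct.map LinearMap.id (rTen k A)

/-- `a ⊗ b ↦ 1 ⊗ a ⊗ b`. -/
def emb23 : TP2 k A →ₗ[k] TP3 k A := TensorProduct.mk k A (TP2 k A) 1

/-- `a ⊗ b ⊗ c ↦ a ⊗ c ⊗ b`. -/
def perm132 : TP3 k A →ₗ[k] TP3 k A := TensorProduct.map LinearMap.id (flipA k A)

/-- `a ⊗ b ⊗ c ↦ b ⊗ c ⊗ a`. -/
def perm231 : TP3 k A →ₗ[k] TP3 k A :=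
  (TensorProduct.assoc k A A A).toLinearMap ∘ₗ (TensorProduct.comm k A (TP2 k A)).toLinearMap

/-- `a ⊗ b ⊗ c ↦ c ⊗ a ⊗ b`. -/
def perm312 : TP3 k A →ₗ[k] TP3 k A :=
  (TensorProduct.comm k (TP2 k A) A).toLinearMap ∘ₗ (TensorProduct.assoc k A A A).symm.toLinearMap

/-- `a ⊗ b ⊗ c ↦ b ⊗ a ⊗ c`. -/
def perm213 : TP3 k A →ₗ[k] TP3 k A :=
  (TensorProduct.assoc k A A A).toLinearMap ∘ₗ
    (TensorProduct.map (flipA k A) LinearMap.id) ∘ₗ (TensorProduct.assoc k A A A).symm.toLinearMap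

variable {k A}

/-- `(Δ ⊗ id)` on two tensor factors, landing in the triple tensor product. -/
def copL (D : A →ₐ[k] TP2 k A) : TP2 k A →ₗ[k] TP3 k A :=
  (TensorProduct.assoc k A A A).toLinearMap ∘ₗ TensorProduct.map D.toLinearMap LinearMap.id

/-- `(id ⊗ Δ)` on two tensor factors. -/
def copR (D : A →ₐ[k] TP2 k A) : TP2 k A →ₗ[k] TP3 k A :=
  TensorProduct.map LinearMap.id D.toLinearMap

/-- `(ε ⊗ id) : A ⊗ A → A`. -/
def cuL (ce : A →ₐ[k] k) : TP2 k A →ₗ[k] A :=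
  (TensorProduct.lid k A).toLinearMap ∘ₗ TensorProduct.map ce.toLinearMap LinearMap.id

/-- `(id ⊗ ε) : A ⊗ A → A`. -/
def cuR (ce : A →ₐ[k] k) : TP2 k A →ₗ[k] A :=
  (TensorProduct.rid k A).toLinearMap ∘ₗ TensorProduct.map LinearMap.id ce.toLinearMap

/-- `(id ⊗ ε ⊗ id) : A ⊗ A ⊗ A → A ⊗ A`. -/
def cuMid (ce : A →ₐ[k] k) : TP3 k A →ₗ[k] TP2 k A :=
  TensorProduct.map LinearMap.id (cuL ce)

/-- `(Δ ⊗ id ⊗ id)`. -/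
def cop4_1 (D : A →ₐ[k] TP2 k A) : TP3 k A →ₗ[k] TP4 k A :=
  (TensorProduct.assoc k A A (TP2 k A)).toLinearMap ∘ₗ TensorProduct.map D.toLinearMap LinearMap.id

/-- `(id ⊗ Δ ⊗ id)`. -/
def cop4_2 (D : A →ₐ[k] TP2 k A) : TP3 k A →ₗ[k] TP4 k A :=
  TensorProduct.map LinearMap.id (copL D)

/-- `(id ⊗ id ⊗ Δ)`. -/
def cop4_3 (D : A →ₐ[k] TP2 k A) : TP3 k A →ₗ[k] TP4 k A :=
  TensorProduct.map LinearMap.id (copR D)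

/-- `a ⊗ b ⊗ c ↦ a ⊗ b ⊗ c ⊗ 1`, i.e. `Φ ↦ Φ ⊗ 1`. -/
def pad4 : TP3 k A →ₗ[k] TP4 k A :=
  TensorProduct.map LinearMap.id (TensorProduct.map LinearMap.id (lTen k A))

/-- `a ⊗ b ⊗ c ↦ f(a) * g(b) * h(c)`. -/
def tmap3 (f g h : A →ₗ[k] A) : TP3 k A →ₗ[k] A :=
  mulA k A ∘ₗ TensorProduct.map f (mulA k A ∘ₗ TensorProduct.map g h)

/-- `a ⊗ b ↦ S(a) * b`, used in the antipode axiom `m ∘ (S ⊗ id) ∘ Δ = 1·ε`. -/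
def antipL (s : A →ₗ[k] A) : TP2 k A →ₗ[k] A := mulA k A ∘ₗ TensorProduct.map s LinearMap.id

/-- `a ⊗ b ↦ a * S(b)`. -/
def antipR (s : A →ₗ[k] A) : TP2 k A →ₗ[k] A := mulA k A ∘ₗ TensorProduct.map LinearMap.id s

end Gadgets

/-- Central idempotent `e₀ = (1 + K²)/2`. -/
def e0 : Q := (2:ℂ)⁻¹ • (1 + gK ^ 2)

/-- Central idempotent `e₁ = (1 − K²)/2`. -/
def e1 : Q := (2:ℂ)⁻¹ • (1 - gK ^ 2)

/-- `f⁺ = −i F`. -/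
def fp : Q := (-Complex.I) • gF

/-- `f⁻ = E K⁻¹`. -/
def fm : Q := gE * gKi

/-- The Casimir element `C = FE − (i/4)(K − K⁻¹)`. -/
def Cas : Q := gF * gE - (Complex.I / 4) • (gK - gKi)

def t2 (a b : Q) : TP2 ℂ Q := a ⊗ₜ[ℂ] b

def t3 (a b c : Q) : TP3 ℂ Q := a ⊗ₜ[ℂ] (b ⊗ₜ[ℂ] c)

def eEF : Q := gE * gF
def eEK : Q := gE * gK
def eFK : Q := gF * gK
def eEFK : Q := gE * gF * gK

/-- `Φ^{010}` component of the coassociator. -/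
def Phi010 : TP3 ℂ Q :=
  t3 1 1 1 - (1 + Complex.I) • t3 gE gK gF + (1 - Complex.I) • t3 eFK gK eEK
    + (2:ℂ) • t3 eEFK 1 eEFK

/-- `Φ^{101}` component of the coassociator. -/
def Phi101 : TP3 ℂ Q :=
  (Complex.I - 1) • t3 1 gF eEK + t3 1 gK 1 + (2:ℂ) • t3 1 eEF eEFK
    - (1 + Complex.I) • t3 1 eEK gF - (1 + Complex.I) • t3 gE eFK 1
    + (2 * Complex.I) • t3 gE eEFK gF + (1 - Complex.I) • t3 eFK gE 1
    - (2 * Complex.I) • t3 eFK eEFK eEK - (2:ℂ) • t3 eEFK eEF 1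

/-- `Φ^{111}` component of the coassociator. -/
def Phi111 (β : ℂ) : TP3 ℂ Q :=
  (Complex.I * β ^ 2) • (
    (1 + Complex.I) • t3 1 gF eEK - t3 1 gK 1 - (2:ℂ) • t3 1 eEF 1
      - (2 * Complex.I) • t3 1 eEF eEFK + (1 + Complex.I) • t3 1 eEK gF
      - (1 + Complex.I) • t3 gE 1 gF + (1 + Complex.I) • t3 gE eFK 1
      + (2 * Complex.I) • t3 gE eFK eEFK + (2:ℂ) • t3 gE eEFK gF
      - (1 + Complex.I) • t3 eFK 1 eEK + (1 + Complex.I) • t3 eFK gE 1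
      + (2 * Complex.I) • t3 eFK gE eEFK + (2:ℂ) • t3 eFK eEFK eEK
      + (2 * Complex.I) • t3 eEFK gF eEK + (2 * Complex.I) • t3 eEFK gK eEFK
      - (2 * Complex.I) • t3 eEFK eEF 1 + (2 * Complex.I) • t3 eEFK eEK gF
      + (4:ℂ) • t3 eEFK eEF eEFK)

/-- The coassociator `Φ` of the quasi-Hopf algebra structure on `Q`. -/
def Phi (β : ℂ) : TP3 ℂ Q :=
  t3 e0 e0 e0 + t3 e1 e0 e0 + Phi010 * t3 e0 e1 e0 + t3 e0 e0 e1
    + t3 e1 e1 e0 + Phi101 * t3 e1 e0 e1 + t3 e0 e1 e1 + Phi111 β * t3 e1 e1 e1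

def R00 : TP2 ℂ Q :=
  (2:ℂ)⁻¹ • ((t2 1 1 + t2 1 gK + t2 gK 1 - t2 gK gK) * (t2 1 1 + (2 * Complex.I) • t2 gE gF))

def R01 : TP2 ℂ Q :=
  (2:ℂ)⁻¹ • ((t2 1 1 - Complex.I • t2 1 gK + t2 gK 1 + Complex.I • t2 gK gK) *
    (t2 1 1 + (1 - Complex.I) • t2 eFK eEK - (1 - Complex.I) • t2 gE gF
      + (1 + Complex.I) • t2 eEFK 1 + (2 * Complex.I) • t2 eEFK eEFK))

def R10 : TP2 ℂ Q :=
  (2:ℂ)⁻¹ • ((t2 1 1 + t2 1 gK - Complex.I • t2 gK 1 + Complex.I • t2 gK gK) *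
    (t2 1 gK + (1 - Complex.I) • t2 eFK gE + (1 - Complex.I) • t2 gE eFK
      - (1 - Complex.I) • t2 1 eEF - (2 * Complex.I) • t2 eEFK eEF))

def R11 (β : ℂ) : TP2 ℂ Q :=
  (β / 2) • ((t2 1 1 - Complex.I • t2 1 gK - Complex.I • t2 gK 1 + t2 gK gK) *
    ((-Complex.I) • t2 gK 1 + (2 * Complex.I) • t2 eEK gF + (1 - Complex.I) • t2 gK eEFK
      - (1 + Complex.I) • t2 eEF 1 - (2 * Complex.I) • t2 eEF eEFK))

/-- The universal R-matrix `R` of the quasi-triangular quasi-Hopf structure on `Q`. -/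
def Rmat (β : ℂ) : TP2 ℂ Q :=
  R00 * t2 e0 e0 + R01 * t2 e0 e1 + R10 * t2 e1 e0 + R11 β * t2 e1 e1

/-- The standard R-matrix `R_st` of the quotient `Q/(K²-1)`. -/
def Rst : TP2 ℂ Q :=
  (2:ℂ)⁻¹ • ∑ m ∈ Finset.range 2, ∑ n ∈ Finset.range 2,
    ((-1:ℂ) ^ (m * n)) • (t2 (gK ^ m) (gK ^ n) * (t2 1 1 + (2 * Complex.I) • t2 gE gF))

/-- The monodromy matrix `M = R₂₁ · R`. -/
def Mmat (β : ℂ) : TP2 ℂ Q := flipA ℂ Q (Rmat β) * Rmat β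

/-- The ribbon element `v = (e₀ − iβ K e₁)(1 − 2 f⁺ f⁻)`. -/
def vRib (β : ℂ) : Q := (e0 - (Complex.I * β) • (gK * e1)) * (1 - (2:ℂ) • (fp * fm))

/-- The coevaluation element `β = e₀ − 2iβ² C e₁`. -/
def bbEl (β : ℂ) : Q := e0 - (2 * Complex.I * β ^ 2) • (Cas * e1)

/-- `b ⊗ c ↦ S(b · bb · S(c))`, inner part of the Drinfeld element. -/
def uInner (S : Q →ₗ[ℂ] Q) (bb : Q) : TP2 ℂ Q →ₗ[ℂ] Q :=
  S ∘ₗ mulA ℂ Q ∘ₗ TensorProduct.map (LinearMap.mulRight ℂ bb) S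

/-- `Φ' ⊗ Φ'' ⊗ Φ''' ↦ S(Φ'' · bb · S(Φ''')) ⊗ Φ'`. -/
def uMap1 (S : Q →ₗ[ℂ] Q) (bb : Q) : TP3 ℂ Q →ₗ[ℂ] TP2 ℂ Q :=
  TensorProduct.map (uInner S bb) LinearMap.id ∘ₗ (TensorProduct.comm ℂ Q (TP2 ℂ Q)).toLinearMap

/-- `R' ⊗ R'' ↦ S(R'') · al · R'`. -/
def uMap2 (S : Q →ₗ[ℂ] Q) (al : Q) : TP2 ℂ Q →ₗ[ℂ] Q :=
  mulA ℂ Q ∘ₗ TensorProduct.map (LinearMap.mulRight ℂ al ∘ₗ S) LinearMap.id ∘ₗ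
    (TensorProduct.comm ℂ Q Q).toLinearMap

/-- `(x ⊗ a) ⊗ (R' ⊗ R'') ↦ x · (S(R'') · al · R') · a`. -/
def uBig (S : Q →ₗ[ℂ] Q) (al : Q) : TP2 ℂ Q ⊗[ℂ] TP2 ℂ Q →ₗ[ℂ] Q :=
  mulA ℂ Q ∘ₗ TensorProduct.map LinearMap.id (mulA ℂ Q ∘ₗ (TensorProduct.comm ℂ Q Q).toLinearMap)
    ∘ₗ (TensorProduct.assoc ℂ Q Q Q).toLinearMap ∘ₗ TensorProduct.map LinearMap.id (uMap2 S al)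

/-- The Drinfeld element `u = Σ S(Φ''·b·S(Φ'''))·S(R'')·α·R'·Φ'` (with `α = 1`). -/
def uDrin (β : ℂ) (S : Q →ₗ[ℂ] Q) : Q :=
  uBig S 1 (uMap1 S (bbEl β) (Phi β) ⊗ₜ[ℂ] Rmat β)

/-- The balancing element `g = b · S(α) · v⁻¹ · u` (with `α = 1`). -/
def balG (β : ℂ) (S : Q →ₗ[ℂ] Q) : Q :=
  bbEl β * S 1 * Ring.inverse (vRib β) * uDrin β S

/-- The cointegral `c = (β²/i)·E·F·(1 + K + K² + K³)`. -/
def cInt (β : ℂ) : Q := (β ^ 2 / Complex.I) • (gE * gF * (1 + gK + gK ^ 2 + gK ^ 3))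

/-- The q-trace of a one-dimensional representation, with balancing element `K⁻¹`. -/
def qTr1 (ρ : Q →ₐ[ℂ] ℂ) : Q →ₗ[ℂ] ℂ := ρ.toLinearMap ∘ₗ LinearMap.mulLeft ℂ gK

/-- The q-trace of a two-dimensional (matrix) representation, with balancing element `K⁻¹`. -/
def qTrM (ρ : Q →ₐ[ℂ] Matrix (Fin 2) (Fin 2) ℂ) : Q →ₗ[ℂ] ℂ :=
  Matrix.traceLinearMap (Fin 2) ℂ ℂ ∘ₗ ρ.toLinearMap ∘ₗ LinearMap.mulLeft ℂ gK

/-- The Drinfeld mapping `φ ↦ (φ ⊗ id)(M)`. -/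
def drinfeldImg (β : ℂ) (φ : Q →ₗ[ℂ] ℂ) : Q :=
  (TensorProduct.lid ℂ Q) (TensorProduct.map φ LinearMap.id (Mmat β))

/-! ### Relations in `Q` -/

lemma q_neg (a : Q) : -a = (-1 : ℂ) • a := (neg_one_smul ℂ a).symm

lemma rel_KKi : gK * gKi = 1 := by
  have := RingQuot.mkAlgHom_rel ℂ QRel.KKi
  simpa [gK, gKi] using this

lemma rel_KiK : gKi * gK = 1 := by
  have := RingQuot.mkAlgHom_rel ℂ QRel.KiK
  simpa [gK, gKi] using this

lemma rel_KE : gK * gE = (-1 : ℂ) • (gE * gK) := by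
  have h := RingQuot.mkAlgHom_rel ℂ QRel.KEKi
  have h' : gK * gE * gKi = (-1 : ℂ) • gE := by
    rw [← q_neg]; simpa [gK, gKi, gE] using h
  calc gK * gE = gK * gE * (gKi * gK) := by rw [rel_KiK, mul_one]
    _ = (gK * gE * gKi) * gK := by simp only [mul_assoc]
    _ = _ := by rw [h', smul_mul_assoc]

lemma rel_KF : gK * gF = (-1 : ℂ) • (gF * gK) := by
  have h := RingQuot.mkAlgHom_rel ℂ QRel.KFKi
  have h' : gK * gF * gKi = (-1 : ℂ) • gF := by
    rw [← q_neg]; simpa [gK, gKi, gF] using h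
  calc gK * gF = gK * gF * (gKi * gK) := by rw [rel_KiK, mul_one]
    _ = (gK * gF * gKi) * gK := by simp only [mul_assoc]
    _ = _ := by rw [h', smul_mul_assoc]

lemma rel_EE : gE * gE = 0 := by
  have h := RingQuot.mkAlgHom_rel ℂ QRel.Esq
  simpa [gE, pow_two] using h

lemma rel_FF : gF * gF = 0 := by
  have h := RingQuot.mkAlgHom_rel ℂ QRel.Fsq
  simpa [gF, pow_two] using h

lemma rel_K4 : gK ^ 4 = 1 := by
  have h := RingQuot.mkAlgHom_rel ℂ QRel.K4
  simpa [gK] using h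

lemma rel_FE : gF * gE = gE * gF - (2 * Complex.I)⁻¹ • (gK - gKi) := by
  have h := RingQuot.mkAlgHom_rel ℂ QRel.EF
  have h' : gE * gF - gF * gE = (2 * Complex.I)⁻¹ • (gK - gKi) := by
    simpa only [gK, gKi, gF, gE, map_sub, map_mul, map_smul] using h
  rw [← h']; abel

lemma rel_Ki : gKi = gK ^ 3 := by
  calc gKi = gKi * gK ^ 4 := by rw [rel_K4, mul_one]
    _ = (gKi * gK) * gK ^ 3 := by rw [pow_succ' gK 3, mul_assoc]
    _ = _ := by rw [rel_KiK, one_mul]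

/-! ### Projectors onto eigenspaces of `K` -/

/-- The projector onto the eigenvalue `l` of `K`. -/
def PK (l : ℂ) : Q := (4:ℂ)⁻¹ • (1 + l ^ 3 • gK + l ^ 2 • gK ^ 2 + l • gK ^ 3)

lemma K_PK (l : ℂ) (hl : l ^ 4 = 1) : gK * PK l = l • PK l := by
  have e1 : gK * gK = gK ^ 2 := (pow_two _).symm
  have e2 : gK * gK ^ 2 = gK ^ 3 := (pow_succ' _ _).symm
  have e3 : gK * gK ^ 3 = 1 := by rw [← pow_succ', rel_K4]
  simp only [PK, mul_smul_comm, mul_add, mul_one, e1, e2, e3]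
  match_scalars
  · linear_combination (-(4:ℂ)⁻¹) * hl
  · ring
  · ring
  · ring

lemma PK_sum : PK 1 + PK Complex.I + PK (-1) + PK (-Complex.I) = 1 := by
  simp only [PK]
  have h2 : Complex.I ^ 2 = -1 := Complex.I_sq
  have h3 : Complex.I ^ 3 = -Complex.I := by rw [pow_succ, h2]; ring
  match_scalars
  · norm_num
  · ring
  · simp [h2]
  · ring

/-! ### Coefficients: `ℕ[x]/(x⁸-1)`, with `x` an eighth root of unity -/

/-- Zero, or a tuple of eight natural numbers. -/
inductive Cf
  | z
  | mk (a b c d e f g h : Nat)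

/-- Abstract zero, addition, and multiplication by powers of `x`. -/
structure Ops (α : Type) where
  z : α
  ad : α → α → α
  rot : Nat → α → α

/-- Scalars are lists of exponents. -/
abbrev Sc := List Nat

def scEv (β : ℂ) (c : Sc) : ℂ := (c.map (fun j => β ^ j)).sum

def Ops.sm {α : Type} (o : Ops α) (c : Sc) (u : α) : α :=
  List.rec (motive := fun _ => α) o.z (fun j _ r => o.ad (o.rot j u) r) c

structure Ops.Lawful {α M : Type} [AddCommGroup M] [Module ℂ M] (β : ℂ) (o : Ops α) (i : α → M) :
    Prop where
  hz : i o.z = 0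
  had : ∀ u v, i (o.ad u v) = i u + i v
  hrot : ∀ j u, i (o.rot j u) = β ^ j • i u

lemma Ops.Lawful.hsm {α M : Type} [AddCommGroup M] [Module ℂ M] {β : ℂ} {o : Ops α} {i : α → M}
    (h : o.Lawful β i) (c : Sc) (u : α) : i (o.sm c u) = scEv β c • i u := by
  induction c with
  | nil => simp [Ops.sm, scEv, h.hz]
  | cons j c ih =>
    have : o.sm (j :: c) u = o.ad (o.rot j u) (o.sm c u) := rfl
    rw [this, h.had, h.hrot, ih, ← add_smul]; simp [scEv]

def Cf.add : Cf → Cf → Cf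
  | .z, v => v
  | .mk a b c d e f g h, .z => .mk a b c d e f g h
  | .mk a b c d e f g h, .mk a' b' c' d' e' f' g' h' =>
    .mk (Nat.add a a') (Nat.add b b') (Nat.add c c') (Nat.add d d') (Nat.add e e') (Nat.add f f')
      (Nat.add g g') (Nat.add h h')

def Cf.rot1 : Cf → Cf
  | .z => .z
  | .mk a b c d e f g h => .mk h a b c d e f g

def Cf.rot (j : Nat) (u : Cf) : Cf :=
  Nat.rec (motive := fun _ => Cf) u (fun _ r => r.rot1) j

def Cf.ops : Ops Cf := ⟨.z, Cf.add, Cf.rot⟩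

def Cf.ev (β : ℂ) : Cf → ℂ
  | .z => 0
  | .mk a b c d e f g h => a + b * β + c * β ^ 2 + d * β ^ 3 + e * β ^ 4 + f * β ^ 5 + g * β ^ 6
      + h * β ^ 7

lemma Cf.ev_add (β : ℂ) (u v : Cf) : (u.add v).ev β = u.ev β + v.ev β := by
  cases u <;> cases v <;> simp only [Cf.ev, Cf.add, Nat.add_eq] <;> push_cast <;> ring

lemma Cf.ev_rot1 (β : ℂ) (hβ : β ^ 4 = -1) (u : Cf) : u.rot1.ev β = β * u.ev β := by
  cases u with
  | z => simp [Cf.ev, Cf.rot1]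
  | mk a b c d e f g h =>
    simp only [Cf.ev, Cf.rot1]
    linear_combination (h : ℂ) * (1 - β ^ 4) * hβ

lemma Cf.ev_rot (β : ℂ) (hβ : β ^ 4 = -1) (j : Nat) (u : Cf) : (u.rot j).ev β = β ^ j * u.ev β := by
  induction j with
  | zero => simp [Cf.rot]
  | succ j ih =>
    have : u.rot (j + 1) = (u.rot j).rot1 := rfl
    rw [this, Cf.ev_rot1 β hβ, ih]; ring

lemma Cf.lawful (β : ℂ) (hβ : β ^ 4 = -1) : Cf.ops.Lawful β (Cf.ev β) :=
  ⟨rfl, Cf.ev_add β, Cf.ev_rot β hβ⟩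

/-- Boolean equality test modulo `x⁴ = -1`. -/
def Cf.eqv : Cf → Cf → Bool
  | .z, .z => true
  | .z, .mk a b c d e f g h => Nat.beq a e && (Nat.beq b f && (Nat.beq c g && Nat.beq d h))
  | .mk a b c d e f g h, .z => Nat.beq a e && (Nat.beq b f && (Nat.beq c g && Nat.beq d h))
  | .mk a b c d e f g h, .mk a' b' c' d' e' f' g' h' =>
    Nat.beq (Nat.add a e') (Nat.add a' e) && (Nat.beq (Nat.add b f') (Nat.add b' f) &&
      (Nat.beq (Nat.add c g') (Nat.add c' g) && Nat.beq (Nat.add d h') (Nat.add d' h)))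

lemma Cf.eqv_ev (β : ℂ) (hβ : β ^ 4 = -1) : ∀ (u v : Cf), u.eqv v = true → u.ev β = v.ev β
  | .z, .z, _ => rfl
  | .z, .mk a b c d e f g h, H => by
    simp only [Cf.eqv, Cf.ev, Bool.and_eq_true, Nat.beq_eq] at H ⊢
    obtain ⟨rfl, rfl, rfl, rfl⟩ := H
    linear_combination -(a + b * β + c * β ^ 2 + d * β ^ 3) * hβ
  | .mk a b c d e f g h, .z, H => by
    simp only [Cf.eqv, Cf.ev, Bool.and_eq_true, Nat.beq_eq] at H ⊢
    obtain ⟨rfl, rfl, rfl, rfl⟩ := H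
    linear_combination (a + b * β + c * β ^ 2 + d * β ^ 3) * hβ
  | .mk a b c d e f g h, .mk a' b' c' d' e' f' g' h', H => by
    simp only [Cf.eqv, Cf.ev, Bool.and_eq_true, Nat.beq_eq, Nat.add_eq] at H ⊢
    obtain ⟨h0, h1, h2, h3⟩ := H
    have h0' : (a + e' : ℂ) = a' + e := by exact_mod_cast h0
    have h1' : (b + f' : ℂ) = b' + f := by exact_mod_cast h1
    have h2' : (c + g' : ℂ) = c' + g := by exact_mod_cast h2
    have h3' : (d + h' : ℂ) = d' + h := by exact_mod_cast h3
    linear_combination h0' + β * h1' + β ^ 2 * h2' + β ^ 3 * h3'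
      + ((e - e') + (f - f') * β + (g - g') * β ^ 2 + (h - h') * β ^ 3) * hβ

/-! ### Vectors -/

/-- Zero, or coordinates with respect to `p, E p, F p, E F p`. -/
inductive V4 (α : Type)
  | z
  | mk (p e f g : α)

def V4.add {α : Type} (ad : α → α → α) : V4 α → V4 α → V4 α
  | .z, v => v
  | .mk a b c d, .z => .mk a b c d
  | .mk a b c d, .mk a' b' c' d' => .mk (ad a a') (ad b b') (ad c c') (ad d d')

def V4.map {α : Type} (f : α → α) : V4 α → V4 α
  | .z => .z
  | .mk a b c d => .mk (f a) (f b) (f c) (f d)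

def V4.ops {α : Type} (o : Ops α) : Ops (V4 α) := ⟨.z, V4.add o.ad, fun j => V4.map (o.rot j)⟩

def vops : Ops (V4 Cf) := V4.ops Cf.ops
def wops : Ops (V4 (V4 Cf)) := V4.ops vops

def V4.eqv {α : Type} (q : α → α → Bool) (z : α) : V4 α → V4 α → Bool
  | .z, .z => true
  | .z, .mk a b c d => q z a && (q z b && (q z c && q z d))
  | .mk a b c d, .z => q a z && (q b z && (q c z && q d z))
  | .mk a b c d, .mk a' b' c' d' => q a a' && (q b b' && (q c c' && q d d'))

def veqv (u v : V4 Cf) : Bool := V4.eqv Cf.eqv .z u v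
def weqv (u v : V4 (V4 Cf)) : Bool := V4.eqv veqv .z u v

/-! Evaluation-forcing combinators: all of them satisfy `fr v k = k v`. -/

def frN {α : Type} (n : Nat) (k : Nat → α) : α :=
  Nat.rec (motive := fun _ => α) (k 0) (fun m _ => k (.succ m)) n

def frC {α : Type} (u : Cf) (k : Cf → α) : α :=
  match u with
  | .z => k .z
  | .mk a b c d e f g h => frN a fun a => frN b fun b => frN c fun c => frN d fun d =>
    frN e fun e => frN f fun f => frN g fun g => frN h fun h => k (.mk a b c d e f g h)

def frV {β : Type} (u : V4 Cf) (k : V4 Cf → β) : β :=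
  match u with
  | .z => k .z
  | .mk a b c d => frC a fun a => frC b fun b => frC c fun c => frC d fun d => k (.mk a b c d)

def frW {β : Type} (u : V4 (V4 Cf)) (k : V4 (V4 Cf) → β) : β :=
  match u with
  | .z => k .z
  | .mk a b c d => frV a fun a => frV b fun b => frV c fun c => frV d fun d => k (.mk a b c d)

lemma frN_eq {α : Type} (n : Nat) (k : Nat → α) : frN n k = k n := by cases n <;> rfl

lemma frC_eq {α : Type} (u : Cf) (k : Cf → α) : frC u k = k u := by
  cases u <;> simp only [frC, frN_eq]

lemma frV_eq {α : Type} (u : V4 Cf) (k : V4 Cf → α) : frV u k = k u := by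
  cases u <;> simp only [frV, frC_eq]

lemma frW_eq {α : Type} (u : V4 (V4 Cf)) (k : V4 (V4 Cf) → α) : frW u k = k u := by
  cases u <;> simp only [frW, frV_eq]

/-- Letters. -/
inductive Gn | E | F | K | Ki | e0 | e1

def Gn.ev : Gn → Q
  | .E => gE | .F => gF | .K => gK | .Ki => gKi | .e0 => _root_.e0 | .e1 => _root_.e1

/-- Eigenvalue data: `K`, `K⁻¹` (exponents of `x`), `±(K - K⁻¹)/(2i)`, `e0`, `e1`. -/
structure Ctx where
  l : Nat
  li : Nat
  n : Sc
  nn : Sc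
  z0 : Bool
  z1 : Bool

/-- The action of a letter on coordinates. -/
def actG {α : Type} (o : Ops α) (x : Ctx) (g : Gn) (u : V4 α) : V4 α :=
  match u with
  | .z => .z
  | .mk p e f h =>
    match g with
    | .E => .mk o.z p o.z f
    | .F => .mk (o.sm x.nn e) o.z (o.ad p (o.sm x.n h)) e
    | .K => .mk (o.rot x.l p) (o.rot (4 + x.l) e) (o.rot (4 + x.l) f) (o.rot x.l h)
    | .Ki => .mk (o.rot x.li p) (o.rot (4 + x.li) e) (o.rot (4 + x.li) f) (o.rot x.li h)
    | .e0 => cond x.z0 (.mk p e f h) .z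
    | .e1 => cond x.z1 (.mk p e f h) .z

structure Ctx.Valid (β : ℂ) (x : Ctx) (p : Q) : Prop where
  hK : gK * p = β ^ x.l • p
  hKi : gKi * p = β ^ x.li • p
  hn : (2 * Complex.I)⁻¹ * (β ^ x.l - β ^ x.li) = scEv β x.n
  hnn : scEv β x.nn = - scEv β x.n
  hz0 : e0 * p = (cond x.z0 1 0 : ℂ) • p
  hz1 : e1 * p = (cond x.z1 1 0 : ℂ) • p

/-- Basis vectors. -/
def bE (p : Q) : Q := gE * p
def bF (p : Q) : Q := gF * p
def bG (p : Q) : Q := gE * (gF * p)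

lemma Ki_E : gKi * gE = (-1 : ℂ) • (gE * gKi) := by
  have h : gE * gK = (-1 : ℂ) • (gK * gE) := by rw [rel_KE, smul_smul]; simp
  calc gKi * gE = gKi * (gE * gK) * gKi := by simp only [mul_assoc, rel_KKi, mul_one]
    _ = (-1 : ℂ) • (gKi * gK * gE * gKi) := by
      rw [h, mul_smul_comm, smul_mul_assoc]; simp only [mul_assoc]
    _ = _ := by rw [rel_KiK, one_mul]

lemma Ki_F : gKi * gF = (-1 : ℂ) • (gF * gKi) := by
  have h : gF * gK = (-1 : ℂ) • (gK * gF) := by rw [rel_KF, smul_smul]; simp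
  calc gKi * gF = gKi * (gF * gK) * gKi := by simp only [mul_assoc, rel_KKi, mul_one]
    _ = (-1 : ℂ) • (gKi * gK * gF * gKi) := by
      rw [h, mul_smul_comm, smul_mul_assoc]; simp only [mul_assoc]
    _ = _ := by rw [rel_KiK, one_mul]

lemma K2_E : gK ^ 2 * gE = gE * gK ^ 2 := by
  rw [pow_two, mul_assoc, rel_KE, mul_smul_comm, ← mul_assoc, rel_KE, smul_mul_assoc, smul_smul,
    mul_assoc]
  simp

lemma K2_F : gK ^ 2 * gF = gF * gK ^ 2 := by
  rw [pow_two, mul_assoc, rel_KF, mul_smul_comm, ← mul_assoc, rel_KF, smul_mul_assoc, smul_smul,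
    mul_assoc]
  simp

lemma e0_E : e0 * gE = gE * e0 := by simp [e0, add_mul, mul_add, K2_E]
lemma e0_F : e0 * gF = gF * e0 := by simp [e0, add_mul, mul_add, K2_F]
lemma e1_E : e1 * gE = gE * e1 := by simp [e1, sub_mul, mul_sub, K2_E]
lemma e1_F : e1 * gF = gF * e1 := by simp [e1, sub_mul, mul_sub, K2_F]


lemma tab_E (p : Q) : gE * bE p = 0 ∧ gE * bF p = bG p ∧ gE * bG p = 0 := by
  refine ⟨?_, rfl, ?_⟩
  · rw [bE, ← mul_assoc, rel_EE, zero_mul]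
  · rw [bG, ← mul_assoc, rel_EE, zero_mul]

lemma tab_sign (a : Q) (c : ℂ) (p : Q) (hE : a * gE = (-1 : ℂ) • (gE * a))
    (hF : a * gF = (-1 : ℂ) • (gF * a))
    (hp : a * p = c • p) :
    a * bE p = (-c) • bE p ∧ a * bF p = (-c) • bF p ∧ a * bG p = c • bG p := by
  refine ⟨?_, ?_, ?_⟩
  · rw [bE, ← mul_assoc, hE, smul_mul_assoc, mul_assoc, hp, mul_smul_comm]; module
  · rw [bF, ← mul_assoc, hF, smul_mul_assoc, mul_assoc, hp, mul_smul_comm]; module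
  · rw [bG, ← mul_assoc, hE, smul_mul_assoc, mul_assoc, ← mul_assoc a, hF, smul_mul_assoc,
      mul_assoc, hp, mul_smul_comm, mul_smul_comm, mul_smul_comm]; module

lemma tab_comm (a : Q) (c : ℂ) (p : Q) (hE : a * gE = gE * a) (hF : a * gF = gF * a)
    (hp : a * p = c • p) :
    a * bE p = c • bE p ∧ a * bF p = c • bF p ∧ a * bG p = c • bG p := by
  refine ⟨?_, ?_, ?_⟩
  · rw [bE, ← mul_assoc, hE, mul_assoc, hp, mul_smul_comm]
  · rw [bF, ← mul_assoc, hF, mul_assoc, hp, mul_smul_comm]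
  · rw [bG, ← mul_assoc, hE, mul_assoc, ← mul_assoc a, hF,
      mul_assoc, hp, mul_smul_comm, mul_smul_comm]

lemma tab_F {β : ℂ} {x : Ctx} {p : Q} (h : x.Valid β p) :
    gF * bE p = bG p + (-(scEv β x.n)) • p ∧ gF * bF p = 0 ∧ gF * bG p = scEv β x.n • bF p := by
  have hFF : gF * bF p = 0 := by rw [bF, ← mul_assoc, rel_FF, zero_mul]
  refine ⟨?_, hFF, ?_⟩
  · rw [bE, ← mul_assoc, rel_FE, sub_mul, smul_mul_assoc, sub_mul, h.hK, h.hKi, ← h.hn, bG,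
      mul_assoc]
    module
  · have hk := (tab_sign gK _ p rel_KE rel_KF h.hK).2.1
    have hki := (tab_sign gKi _ p Ki_E Ki_F h.hKi).2.1
    have : bG p = gE * bF p := rfl
    rw [this, ← mul_assoc, rel_FE, sub_mul, smul_mul_assoc, sub_mul, hk, hki, ← h.hn, mul_assoc,
      hFF, mul_zero]
    module

/-- The element of `Q p` with given coordinates. -/
def ev1 (β : ℂ) (p : Q) : V4 Cf → Q
  | .z => 0
  | .mk a b c d => a.ev β • p + b.ev β • bE p + c.ev β • bF p + d.ev β • bG p

/-- The element of `Q p ⊗ Q r` with given coordinates. -/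
def ev2 (β : ℂ) (p r : Q) : V4 (V4 Cf) → TP2 ℂ Q
  | .z => 0
  | .mk a b c d => p ⊗ₜ[ℂ] ev1 β r a + bE p ⊗ₜ[ℂ] ev1 β r b + bF p ⊗ₜ[ℂ] ev1 β r c
    + bG p ⊗ₜ[ℂ] ev1 β r d

lemma law1 (β : ℂ) (hβ : β ^ 4 = -1) (p : Q) : vops.Lawful β (ev1 β p) := by
  refine ⟨rfl, ?_, ?_⟩
  · intro u v
    cases u <;> cases v <;> simp only [vops, V4.ops, V4.add, ev1, Cf.ops, Cf.ev_add] <;> module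
  · intro j u
    cases u <;> simp only [vops, V4.ops, V4.map, ev1, Cf.ops, Cf.ev_rot β hβ] <;> module

lemma law2 (β : ℂ) (hβ : β ^ 4 = -1) (p r : Q) : wops.Lawful β (ev2 β p r) := by
  have h := law1 β hβ r
  refine ⟨rfl, ?_, ?_⟩
  · intro u v
    cases u <;> cases v <;>
      simp only [wops, V4.ops, V4.add, ev2, h.had, tmul_add, zero_add, add_zero] <;> abel
  · intro j u
    cases u <;> simp only [wops, V4.ops, V4.map, ev2, h.hrot, tmul_smul, smul_add, smul_zero]

lemma eqv1 (β : ℂ) (hβ : β ^ 4 = -1) (p : Q) (u v : V4 Cf) (h : veqv u v = true) :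
    ev1 β p u = ev1 β p v := by
  have hz : Cf.ev β .z = 0 := rfl
  cases u <;> cases v <;> simp only [veqv, V4.eqv, Bool.and_eq_true] at h
  · rfl
  · obtain ⟨h1, h2, h3, h4⟩ := h
    simp only [ev1, ← Cf.eqv_ev β hβ _ _ h1, ← Cf.eqv_ev β hβ _ _ h2, ← Cf.eqv_ev β hβ _ _ h3,
      ← Cf.eqv_ev β hβ _ _ h4, hz]
    module
  · obtain ⟨h1, h2, h3, h4⟩ := h
    simp only [ev1, Cf.eqv_ev β hβ _ _ h1, Cf.eqv_ev β hβ _ _ h2, Cf.eqv_ev β hβ _ _ h3,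
      Cf.eqv_ev β hβ _ _ h4, hz]
    module
  · obtain ⟨h1, h2, h3, h4⟩ := h
    simp only [ev1, Cf.eqv_ev β hβ _ _ h1, Cf.eqv_ev β hβ _ _ h2, Cf.eqv_ev β hβ _ _ h3,
      Cf.eqv_ev β hβ _ _ h4]

lemma eqv2 (β : ℂ) (hβ : β ^ 4 = -1) (p r : Q) (u v : V4 (V4 Cf)) (h : weqv u v = true) :
    ev2 β p r u = ev2 β p r v := by
  have hz : ev1 β r .z = 0 := rfl
  cases u <;> cases v <;> simp only [weqv, V4.eqv, Bool.and_eq_true] at h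
  · rfl
  · obtain ⟨h1, h2, h3, h4⟩ := h
    simp only [ev2, ← eqv1 β hβ r _ _ h1, ← eqv1 β hβ r _ _ h2, ← eqv1 β hβ r _ _ h3,
      ← eqv1 β hβ r _ _ h4, hz, tmul_zero, add_zero]
  · obtain ⟨h1, h2, h3, h4⟩ := h
    simp only [ev2, eqv1 β hβ r _ _ h1, eqv1 β hβ r _ _ h2, eqv1 β hβ r _ _ h3,
      eqv1 β hβ r _ _ h4, hz, tmul_zero, add_zero]
  · obtain ⟨h1, h2, h3, h4⟩ := h
    simp only [ev2, eqv1 β hβ r _ _ h1, eqv1 β hβ r _ _ h2, eqv1 β hβ r _ _ h3,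
      eqv1 β hβ r _ _ h4]

lemma act1_eq {β : ℂ} (hβ : β ^ 4 = -1) {x : Ctx} {p : Q} (h : x.Valid β p) (g : Gn)
    (u : V4 Cf) : g.ev * ev1 β p u = ev1 β p (actG Cf.ops x g u) := by
  have L := Cf.lawful β hβ
  cases u with
  | z => simp only [ev1, actG, mul_zero]
  | mk a b c d =>
  cases g
  · obtain ⟨h1, h2, h3⟩ := tab_E p
    have h0 : gE * p = bE p := rfl
    simp only [Gn.ev, ev1, actG, mul_add, mul_smul_comm, h0, h1, h2, h3, L.hz]; module
  · obtain ⟨h1, h2, h3⟩ := tab_F h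
    have h0 : gF * p = bF p := rfl
    simp only [Gn.ev, ev1, actG, mul_add, mul_smul_comm, h0, h1, h2, h3, L.hz, L.had, L.hsm,
      h.hnn, smul_eq_mul]; module
  · obtain ⟨h1, h2, h3⟩ := tab_sign gK _ p rel_KE rel_KF h.hK
    simp only [Gn.ev, ev1, actG, mul_add, mul_smul_comm, h.hK, h1, h2, h3, L.hrot, smul_eq_mul,
      pow_add, hβ]
    module
  · obtain ⟨h1, h2, h3⟩ := tab_sign gKi _ p Ki_E Ki_F h.hKi
    simp only [Gn.ev, ev1, actG, mul_add, mul_smul_comm, h.hKi, h1, h2, h3, L.hrot, smul_eq_mul,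
      pow_add, hβ]
    module
  · have hz := h.hz0
    obtain ⟨h1, h2, h3⟩ := tab_comm e0 _ p e0_E e0_F hz
    simp only [Gn.ev, ev1, actG, mul_add, mul_smul_comm, hz, h1, h2, h3]
    cases x.z0 <;> simp [ev1]
  · have hz := h.hz1
    obtain ⟨h1, h2, h3⟩ := tab_comm e1 _ p e1_E e1_F hz
    simp only [Gn.ev, ev1, actG, mul_add, mul_smul_comm, hz, h1, h2, h3]
    cases x.z1 <;> simp [ev1]

lemma act2L_eq {β : ℂ} (hβ : β ^ 4 = -1) {x : Ctx} {p : Q} (h : x.Valid β p) (r : Q) (g : Gn)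
    (w : V4 (V4 Cf)) :
    (g.ev ⊗ₜ[ℂ] (1 : Q)) * ev2 β p r w = ev2 β p r (actG vops x g w) := by
  have L := law1 β hβ r
  cases w with
  | z => simp only [ev2, actG, mul_zero]
  | mk a b c d =>
  cases g
  · obtain ⟨h1, h2, h3⟩ := tab_E p
    have h0 : gE * p = bE p := rfl
    simp only [Gn.ev, ev2, actG, mul_add, Algebra.TensorProduct.tmul_mul_tmul, one_mul, h0, h1, h2,
      h3, L.hz, zero_tmul, tmul_zero]; abel
  · obtain ⟨h1, h2, h3⟩ := tab_F h
    have h0 : gF * p = bF p := rfl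
    simp only [Gn.ev, ev2, actG, mul_add, Algebra.TensorProduct.tmul_mul_tmul, one_mul, h0, h1, h2,
      h3, L.hz, zero_tmul, tmul_zero, L.had, L.hsm, tmul_add, add_tmul, tmul_smul,
      ← smul_tmul', h.hnn]; abel
  · obtain ⟨h1, h2, h3⟩ := tab_sign gK _ p rel_KE rel_KF h.hK
    simp only [Gn.ev, ev2, actG, mul_add, Algebra.TensorProduct.tmul_mul_tmul, one_mul, h.hK, h1,
      h2, h3, L.hrot, tmul_smul, ← smul_tmul', pow_add, hβ, neg_mul]
  · obtain ⟨h1, h2, h3⟩ := tab_sign gKi _ p Ki_E Ki_F h.hKi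
    simp only [Gn.ev, ev2, actG, mul_add, Algebra.TensorProduct.tmul_mul_tmul, one_mul, h.hKi, h1,
      h2, h3, L.hrot, tmul_smul, ← smul_tmul', pow_add, hβ, neg_mul]
  · have hz := h.hz0
    obtain ⟨h1, h2, h3⟩ := tab_comm e0 _ p e0_E e0_F hz
    simp only [Gn.ev, ev2, actG, mul_add, Algebra.TensorProduct.tmul_mul_tmul, one_mul, hz, h1,
      h2, h3]
    cases x.z0 <;> simp [ev2]
  · have hz := h.hz1
    obtain ⟨h1, h2, h3⟩ := tab_comm e1 _ p e1_E e1_F hz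
    simp only [Gn.ev, ev2, actG, mul_add, Algebra.TensorProduct.tmul_mul_tmul, one_mul, hz, h1,
      h2, h3]
    cases x.z1 <;> simp [ev2]

def act1 (x : Ctx) (g : Gn) (u : V4 Cf) : V4 Cf := actG Cf.ops x g u
def act2L (x : Ctx) (g : Gn) (w : V4 (V4 Cf)) : V4 (V4 Cf) := actG vops x g w
def act2R (y : Ctx) (g : Gn) (w : V4 (V4 Cf)) : V4 (V4 Cf) := V4.map (act1 y g) w

lemma act2R_eq {β : ℂ} (hβ : β ^ 4 = -1) {y : Ctx} {r : Q} (h : y.Valid β r) (p : Q) (g : Gn)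
    (w : V4 (V4 Cf)) :
    ((1 : Q) ⊗ₜ[ℂ] g.ev) * ev2 β p r w = ev2 β p r (act2R y g w) := by
  cases w <;> simp only [ev2, act2R, V4.map, act1, mul_add, mul_zero,
    Algebra.TensorProduct.tmul_mul_tmul, one_mul, act1_eq hβ h]

/-- Words. -/
def wordEv (l : List Gn) : Q := (l.map Gn.ev).prod

def actW {V : Type} (fr : V → (V → V) → V) (a : Gn → V → V) (l : List Gn) (u : V) : V :=
  List.rec (motive := fun _ => V) u (fun g _ r => fr r fun v => fr (a g v) id) l

lemma actW_cons {V : Type} (fr : V → (V → V) → V) (hfr : ∀ v k, fr v k = k v) (a : Gn → V → V)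
    (g : Gn) (l : List Gn) (u : V) : actW fr a (g :: l) u = a g (actW fr a l u) := by
  have : actW fr a (g :: l) u = fr (actW fr a l u) fun v => fr (a g v) id := rfl
  rw [this, hfr, hfr, id]

/-! ### Expressions -/

/-- Noncommutative polynomial expressions over an alphabet. -/
inductive Ex (W : Type)
  | w : W → Ex W
  | s : Sc → Ex W → Ex W
  | add : Ex W → Ex W → Ex W
  | mul : Ex W → Ex W → Ex W

def Ex.ev {W A : Type} [Ring A] [Algebra ℂ A] (β : ℂ) (f : W → A) : Ex W → A
  | .w a => f a
  | .s c e => scEv β c • e.ev β f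
  | .add a b => a.ev β f + b.ev β f
  | .mul a b => a.ev β f * b.ev β f

def Ex.act {W V : Type} (fr : V → (V → V) → V) (o : Ops V) (f : W → V → V) (e : Ex W) : V → V :=
  Ex.rec (motive := fun _ => V → V) (fun a u => f a u)
    (fun c _ r u => fr (r u) fun v => fr (o.sm c v) id)
    (fun _ _ r r' u => fr (r u) fun v => fr (r' u) fun v' => fr (o.ad v v') id)
    (fun _ _ r r' u => fr (r' u) r) e

lemma Ex.act_eq {W V A : Type} [Ring A] [Algebra ℂ A] (β : ℂ) (f : W → A)
    (fr : V → (V → V) → V) (hfr : ∀ v k, fr v k = k v)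
    (o : Ops V) (fv : W → V → V) (i : V → A) (L : o.Lawful β i)
    (hf : ∀ a u, f a * i u = i (fv a u)) (e : Ex W) :
    ∀ u, e.ev β f * i u = i (e.act fr o fv u) := by
  induction e with
  | w a => intro u; exact hf a u
  | s c e ih =>
    intro u
    have : (Ex.s c e).act fr o fv u = fr (e.act fr o fv u) fun v => fr (o.sm c v) id := rfl
    simp only [Ex.ev, this, hfr, id, L.hsm, smul_mul_assoc, ih]
  | add a b iha ihb =>
    intro u
    have : (Ex.add a b).act fr o fv u = fr (a.act fr o fv u) fun v => fr (b.act fr o fv u)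
      fun v' => fr (o.ad v v') id := rfl
    simp only [Ex.ev, this, hfr, id, L.had, add_mul, iha, ihb]
  | mul a b iha ihb =>
    intro u
    have : (Ex.mul a b).act fr o fv u = fr (b.act fr o fv u) (a.act fr o fv) := rfl
    simp only [Ex.ev, this, hfr, mul_assoc, iha, ihb]

abbrev Ex1 := Ex (List Gn)
abbrev Ex2 := Ex (List Gn × List Gn)

def Ex1.ev (β : ℂ) (e : Ex1) : Q := Ex.ev β wordEv e
def f2 (a : List Gn × List Gn) : TP2 ℂ Q := wordEv a.1 ⊗ₜ[ℂ] wordEv a.2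
def Ex2.ev (β : ℂ) (e : Ex2) : TP2 ℂ Q := Ex.ev β f2 e
def Ex1.act (x : Ctx) (e : Ex1) (u : V4 Cf) : V4 Cf := Ex.act frV vops (actW frV (act1 x)) e u
def Ex2.act (x y : Ctx) (e : Ex2) (u : V4 (V4 Cf)) : V4 (V4 Cf) :=
  Ex.act frW wops
    (fun a u => frW (actW frW (act2R y) a.2 u) fun v => actW frW (act2L x) a.1 v) e u

lemma Ex1.act_eq {β : ℂ} (hβ : β ^ 4 = -1) {x : Ctx} {p : Q} (h : x.Valid β p) (e : Ex1)
    (u : V4 Cf) : Ex1.ev β e * ev1 β p u = ev1 β p (Ex1.act x e u) := by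
  refine Ex.act_eq β wordEv frV frV_eq vops _ (ev1 β p) (law1 β hβ p) ?_ e u
  intro l
  induction l with
  | nil => intro u; simp [wordEv, actW]
  | cons g l ih =>
    intro u
    have : wordEv (g :: l) = g.ev * wordEv l := by simp [wordEv]
    rw [this, mul_assoc, ih, act1_eq hβ h]; rw [actW_cons frV frV_eq]; rfl

lemma Ex2.act_eq {β : ℂ} (hβ : β ^ 4 = -1) {x y : Ctx} {p r : Q} (hx : x.Valid β p)
    (hy : y.Valid β r) (e : Ex2) (u : V4 (V4 Cf)) :
    Ex2.ev β e * ev2 β p r u = ev2 β p r (Ex2.act x y e u) := by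
  refine Ex.act_eq β f2 frW frW_eq wops _ (ev2 β p r) (law2 β hβ p r) ?_ e u
  have hl : ∀ (l : List Gn) u, (wordEv l ⊗ₜ[ℂ] (1 : Q)) * ev2 β p r u
      = ev2 β p r (actW frW (act2L x) l u) := by
    intro l
    induction l with
    | nil =>
      intro u
      simp [wordEv, actW, ← Algebra.TensorProduct.one_def]
    | cons g l ih =>
      intro u
      have : wordEv (g :: l) ⊗ₜ[ℂ] (1 : Q) = (g.ev ⊗ₜ[ℂ] (1 : Q)) * (wordEv l ⊗ₜ[ℂ] (1 : Q)) := by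
        simp [wordEv]
      rw [this, mul_assoc, ih, act2L_eq hβ hx]; rw [actW_cons frW frW_eq]; rfl
  have hr : ∀ (l : List Gn) u, ((1 : Q) ⊗ₜ[ℂ] wordEv l) * ev2 β p r u
      = ev2 β p r (actW frW (act2R y) l u) := by
    intro l
    induction l with
    | nil =>
      intro u
      simp [wordEv, actW, ← Algebra.TensorProduct.one_def]
    | cons g l ih =>
      intro u
      have : (1 : Q) ⊗ₜ[ℂ] wordEv (g :: l) = ((1 : Q) ⊗ₜ[ℂ] g.ev) * ((1 : Q) ⊗ₜ[ℂ] wordEv l) := by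
        simp [wordEv]
      rw [this, mul_assoc, ih, act2R_eq hβ hy]; rw [actW_cons frW frW_eq]
  intro a u
  have : f2 a = (wordEv a.1 ⊗ₜ[ℂ] (1 : Q)) * ((1 : Q) ⊗ₜ[ℂ] wordEv a.2) := by simp [f2]
  rw [this, mul_assoc, hr, hl, frW_eq]

/-- The vectors `p` and `p ⊗ r`. -/
def vp : V4 Cf := .mk (.mk 1 0 0 0 0 0 0 0) .z .z .z
def wp : V4 (V4 Cf) := .mk vp .z .z .z

lemma ev1_vp (β : ℂ) (p : Q) : ev1 β p vp = p := by simp [ev1, vp, Cf.ev]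
lemma ev2_wp (β : ℂ) (p r : Q) : ev2 β p r wp = p ⊗ₜ[ℂ] r := by
  have : ev1 β r .z = 0 := rfl
  simp only [ev2, wp, ev1_vp, this, tmul_zero, add_zero]

/-! ### The four eigenvalues; here `i = x ^ t` with `t = 2` or `t = 6` -/

def ctxs (t : Nat) : List Ctx :=
  [⟨0, 0, [], [], true, false⟩,
   ⟨t, 4 + t, [0], [4], false, true⟩,
   ⟨4, 4, [], [], true, false⟩,
   ⟨4 + t, t, [4], [0], false, true⟩]

lemma valid_of (β : ℂ) (x : Ctx) (l : ℂ) (hl : l ^ 4 = 1) (h1 : β ^ x.l = l)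
    (h2 : β ^ x.li = l ^ 3) (h3 : (2 * Complex.I)⁻¹ * (l - l ^ 3) = scEv β x.n)
    (h3' : scEv β x.nn = - scEv β x.n)
    (h4 : (cond x.z0 1 0 : ℂ) = 2⁻¹ * (1 + l ^ 2)) (h5 : (cond x.z1 1 0 : ℂ) = 2⁻¹ * (1 - l ^ 2)) :
    x.Valid β (PK l) := by
  have hK := K_PK l hl
  have hK2 : gK ^ 2 * PK l = l ^ 2 • PK l := by
    rw [pow_two, mul_assoc, hK, mul_smul_comm, hK, smul_smul, pow_two]
  refine ⟨by rw [h1, hK], ?_, by rw [h1, h2, h3], h3', ?_, ?_⟩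
  · rw [rel_Ki, pow_succ', mul_assoc, hK2, mul_smul_comm, hK, smul_smul, h2]; ring_nf
  · rw [h4, e0, smul_mul_assoc, add_mul, hK2, one_mul]; module
  · rw [h5, e1, smul_mul_assoc, sub_mul, hK2, one_mul]; module

lemma I_cube : Complex.I ^ 3 = -Complex.I := by
  linear_combination Complex.I * Complex.I_sq

lemma exists_valid (β : ℂ) (hβ : β ^ 4 = -1) (t : Nat) (ht : β ^ t = Complex.I) :
    ∃ P : Ctx → Q, (∀ x ∈ ctxs t, x.Valid β (P x)) ∧ ((ctxs t).map P).sum = 1 := by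
  have hI2 := Complex.I_sq
  have hI3 := I_cube
  have hI0 := Complex.I_ne_zero
  have h4t : β ^ (4 + t) = -Complex.I := by rw [pow_add, hβ, ht]; ring
  refine ⟨fun x => PK (β ^ x.l), ?_, ?_⟩
  · intro x hx
    simp only [ctxs, List.mem_cons, List.not_mem_nil, or_false] at hx
    rcases hx with rfl | rfl | rfl | rfl
    · apply valid_of <;> simp [scEv]
      norm_num
    · apply valid_of <;> simp [scEv, ht, h4t, hI3, hβ]
      · linear_combination (-1 : ℂ) * hI2
      · norm_num
    · apply valid_of <;> simp [scEv, hβ] <;> norm_num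
    · apply valid_of <;> simp [scEv, ht, h4t, hβ]
      all_goals try rw [Odd.neg_pow (by decide), hI3]
      all_goals try norm_num
      all_goals linear_combination (-1 : ℂ) * hI2
  · simp only [ctxs, List.map_cons, List.map_nil, List.sum_cons, List.sum_nil, ht, h4t, hβ,
      pow_zero]
    rw [← PK_sum]; abel

lemma check1 {β : ℂ} (hβ : β ^ 4 = -1) (t : Nat) (ht : β ^ t = Complex.I) (a b : Ex1)
    (h : ∀ x ∈ ctxs t, veqv (Ex1.act x a vp) (Ex1.act x b vp) = true) : Ex1.ev β a = Ex1.ev β b := by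
  obtain ⟨P, hP, hsum⟩ := exists_valid β hβ t ht
  have key : ∀ x ∈ ctxs t, Ex1.ev β a * P x = Ex1.ev β b * P x := by
    intro x hx
    have ha := Ex1.act_eq hβ (hP x hx) a vp
    have hb := Ex1.act_eq hβ (hP x hx) b vp
    rw [ev1_vp] at ha hb
    rw [ha, hb]
    exact eqv1 β hβ _ _ _ (h x hx)
  rw [← mul_one (Ex1.ev β a), ← mul_one (Ex1.ev β b), ← hsum]
  simp only [ctxs, List.map_cons, List.map_nil, List.sum_cons, List.sum_nil, mul_add, mul_zero]
  simp only [ctxs, List.mem_cons, List.not_mem_nil, or_false, forall_eq_or_imp, forall_eq] at key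
  rw [key.1, key.2.1, key.2.2.1, key.2.2.2]

lemma check2 {β : ℂ} (hβ : β ^ 4 = -1) (t : Nat) (ht : β ^ t = Complex.I) (a b : Ex2)
    (h : ∀ x ∈ ctxs t, ∀ y ∈ ctxs t, weqv (Ex2.act x y a wp) (Ex2.act x y b wp) = true) :
    Ex2.ev β a = Ex2.ev β b := by
  obtain ⟨P, hP, hsum⟩ := exists_valid β hβ t ht
  have key : ∀ x ∈ ctxs t, ∀ y ∈ ctxs t,
      Ex2.ev β a * (P x ⊗ₜ[ℂ] P y) = Ex2.ev β b * (P x ⊗ₜ[ℂ] P y) := by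
    intro x hx y hy
    have ha := Ex2.act_eq hβ (hP x hx) (hP y hy) a wp
    have hb := Ex2.act_eq hβ (hP x hx) (hP y hy) b wp
    rw [ev2_wp] at ha hb
    rw [ha, hb]
    exact eqv2 β hβ _ _ _ _ (h x hx y hy)
  have key1 : ∀ x ∈ ctxs t,
      Ex2.ev β a * (P x ⊗ₜ[ℂ] (1 : Q)) = Ex2.ev β b * (P x ⊗ₜ[ℂ] (1 : Q)) := by
    intro x hx
    have k := key x hx
    rw [← hsum]
    simp only [ctxs, List.map_cons, List.map_nil, List.sum_cons, List.sum_nil, mul_add, mul_zero,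
      tmul_add, tmul_zero]
    simp only [ctxs, List.mem_cons, List.not_mem_nil, or_false, forall_eq_or_imp, forall_eq] at k
    rw [k.1, k.2.1, k.2.2.1, k.2.2.2]
  rw [← mul_one (Ex2.ev β a), ← mul_one (Ex2.ev β b), Algebra.TensorProduct.one_def]
  nth_rewrite 1 3 [← hsum]
  simp only [ctxs, List.map_cons, List.map_nil, List.sum_cons, List.sum_nil, mul_add, mul_zero,
      add_tmul, zero_tmul]
  simp only [ctxs, List.mem_cons, List.not_mem_nil, or_false, forall_eq_or_imp, forall_eq] at key1
  rw [key1.1, key1.2.1, key1.2.2.1, key1.2.2.2]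


/-! ### Scalars -/

lemma sc_o (β : ℂ) :
    scEv β [0] = 1 := by
  simp [scEv, pow_add]

lemma sc_m (β : ℂ) (hβ : β ^ 4 = -1) :
    scEv β [4] = -1 := by
  simp [scEv, pow_add, hβ]

lemma sc_i (β : ℂ) (t : Nat) (ht : β ^ t = Complex.I) :
    scEv β [t] = Complex.I := by
  simp [scEv, pow_add, ht]

lemma sc_ni (β : ℂ) (hβ : β ^ 4 = -1) (t : Nat) (ht : β ^ t = Complex.I) :
    scEv β [4 + t] = -Complex.I := by
  simp [scEv, pow_add, hβ, ht]

lemma sc_q (β : ℂ) (t : Nat) (ht : β ^ t = Complex.I) :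
    scEv β [0, t] = 1 + Complex.I := by
  simp [scEv, ht] <;> ring

lemma sc_r (β : ℂ) (hβ : β ^ 4 = -1) (t : Nat) (ht : β ^ t = Complex.I) :
    scEv β [0, 4 + t] = 1 - Complex.I := by
  simp [scEv, pow_add, hβ, ht] <;> ring

lemma sc_nr (β : ℂ) (hβ : β ^ 4 = -1) (t : Nat) (ht : β ^ t = Complex.I) :
    scEv β [4, t] = -(1 - Complex.I) := by
  simp [scEv, pow_add, hβ, ht] <;> ring

lemma sc_nq (β : ℂ) (hβ : β ^ 4 = -1) (t : Nat) (ht : β ^ t = Complex.I) :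
    scEv β [4, 4 + t] = -(1 + Complex.I) := by
  simp [scEv, pow_add, hβ, ht] <;> ring

lemma sc_d (β : ℂ) (t : Nat) (ht : β ^ t = Complex.I) :
    scEv β [t, t] = 2 * Complex.I := by
  simp [scEv, ht] <;> ring

lemma sc_nd (β : ℂ) (hβ : β ^ 4 = -1) (t : Nat) (ht : β ^ t = Complex.I) :
    scEv β [4 + t, 4 + t] = -(2 * Complex.I) := by
  simp [scEv, pow_add, hβ, ht] <;> ring

lemma sc_b (β : ℂ) :
    scEv β [1] = β := by
  simp [scEv, pow_add]

lemma sc_nib (β : ℂ) (hβ : β ^ 4 = -1) (t : Nat) (ht : β ^ t = Complex.I) :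
    scEv β [5 + t] = -(Complex.I * β) := by
  have h5 : β ^ 5 = -β := by rw [pow_succ, hβ, neg_one_mul]
  simp [scEv, pow_add, h5, ht]; ring

lemma sc_two (β : ℂ) :
    scEv β [0, 0] = 2 := by
  simp [scEv, pow_add] <;> ring

lemma sc_four (β : ℂ) :
    scEv β [0, 0, 0, 0] = 4 := by
  simp [scEv, pow_add] <;> ring

lemma sc_fi (β : ℂ) (t : Nat) (ht : β ^ t = Complex.I) :
    scEv β [t, t, t, t] = 4 * Complex.I := by
  simp [scEv, ht] <;> ring

lemma sc_eight (β : ℂ) :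
    scEv β [0, 0, 0, 0, 0, 0, 0, 0] = 8 := by
  simp [scEv, pow_add] <;> ring


/-! ### The concrete expressions -/

def Ex.swap : Ex2 → Ex2
  | .w a => .w (a.2, a.1)
  | .s c e => .s c e.swap
  | .add a b => .add a.swap b.swap
  | .mul a b => .mul a.swap b.swap

def Ex.lift (f : List Gn → List Gn × List Gn) : Ex1 → Ex2
  | .w a => .w (f a)
  | .s c e => .s c (e.lift f)
  | .add a b => .add (a.lift f) (b.lift f)
  | .mul a b => .mul (a.lift f) (b.lift f)

lemma flipA_mul (a b : TP2 ℂ Q) : flipA ℂ Q (a * b) = flipA ℂ Q a * flipA ℂ Q b :=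
  map_mul (Algebra.TensorProduct.comm ℂ Q Q) a b

lemma swap_ev (β : ℂ) (e : Ex2) : Ex2.ev β e.swap = flipA ℂ Q (Ex2.ev β e) := by
  induction e with
  | w a => rfl
  | s c e ih => simp only [Ex2.ev, Ex.ev, Ex.swap, map_smul] at ih ⊢; rw [ih]
  | add a b iha ihb => simp only [Ex2.ev, Ex.ev, Ex.swap, map_add] at iha ihb ⊢; rw [iha, ihb]
  | mul a b iha ihb => simp only [Ex2.ev, Ex.ev, Ex.swap, flipA_mul] at iha ihb ⊢; rw [iha, ihb]

lemma lift_evL (β : ℂ) (e : Ex1) :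
    Ex2.ev β (e.lift (fun l => (l, []))) = Ex1.ev β e ⊗ₜ[ℂ] (1 : Q) := by
  induction e with
  | w a => simp [Ex2.ev, Ex1.ev, Ex.ev, Ex.lift, f2, wordEv]
  | s c e ih => simp only [Ex2.ev, Ex1.ev, Ex.ev, Ex.lift] at ih ⊢; rw [ih, smul_tmul']
  | add a b iha ihb =>
    simp only [Ex2.ev, Ex1.ev, Ex.ev, Ex.lift] at iha ihb ⊢; rw [iha, ihb, add_tmul]
  | mul a b iha ihb =>
    simp only [Ex2.ev, Ex1.ev, Ex.ev, Ex.lift] at iha ihb ⊢; rw [iha, ihb]; simp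

lemma lift_evR (β : ℂ) (e : Ex1) :
    Ex2.ev β (e.lift (fun l => ([], l))) = (1 : Q) ⊗ₜ[ℂ] Ex1.ev β e := by
  induction e with
  | w a => simp [Ex2.ev, Ex1.ev, Ex.ev, Ex.lift, f2, wordEv]
  | s c e ih => simp only [Ex2.ev, Ex1.ev, Ex.ev, Ex.lift] at ih ⊢; rw [ih, tmul_smul]
  | add a b iha ihb =>
    simp only [Ex2.ev, Ex1.ev, Ex.ev, Ex.lift] at iha ihb ⊢; rw [iha, ihb, tmul_add]
  | mul a b iha ihb =>
    simp only [Ex2.ev, Ex1.ev, Ex.ev, Ex.lift] at iha ihb ⊢; rw [iha, ihb]; simp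

/-- Scaled word in two tensor factors. -/
def ct (c : Sc) (a b : List Gn) : Ex2 := .s c (.w (a, b))
/-- Scaled word. -/
def cw (c : Sc) (a : List Gn) : Ex1 := .s c (.w a)

open Gn in
/-- `2 R`. -/
def RE (t : Nat) : Ex2 :=
  ((((ct [0] [] []).add (ct [0] [] [K])).add (ct [0] [K] [])).add (ct [4] [K] [K])).mul
      (((ct [0] [] []).add (ct [t, t] [E] [F])).mul (ct [0] [e0] [e0]))
  |>.add (((((ct [0] [] []).add (ct [4 + t] [] [K])).add (ct [0] [K] [])).add (ct [t] [K] [K])).mul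
      ((((((ct [0] [] []).add (ct [0, 4 + t] [F, K] [E, K])).add (ct [4, t] [E] [F])).add
        (ct [0, t] [E, F, K] [])).add (ct [t, t] [E, F, K] [E, F, K])).mul (ct [0] [e0] [e1])))
  |>.add (((((ct [0] [] []).add (ct [0] [] [K])).add (ct [4 + t] [K] [])).add (ct [t] [K] [K])).mul
      ((((((ct [0] [] [K]).add (ct [0, 4 + t] [F, K] [E])).add (ct [0, 4 + t] [E] [F, K])).add
        (ct [4, t] [] [E, F])).add (ct [4 + t, 4 + t] [E, F, K] [E, F])).mul (ct [0] [e1] [e0])))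
  |>.add (((((ct [0] [] []).add (ct [4 + t] [] [K])).add (ct [4 + t] [K] [])).add (ct [0] [K] [K])).mul
      ((((((ct [4 + t] [K] []).add (ct [t, t] [E, K] [F])).add (ct [0, 4 + t] [K] [E, F, K])).add
        (ct [4, 4 + t] [E, F] [])).add (ct [4 + t, 4 + t] [E, F] [E, F, K])).mul (ct [1] [e1] [e1])))

lemma ct_ev (β : ℂ) (c : Sc) (a b : List Gn) :
    Ex.ev β f2 (ct c a b) = scEv β c • t2 (wordEv a) (wordEv b) := rfl

lemma cw_ev (β : ℂ) (c : Sc) (a : List Gn) :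
    Ex.ev β wordEv (cw c a) = scEv β c • wordEv a := rfl

lemma wordEv_nil : wordEv [] = 1 := rfl
lemma wordEv_one (a : Gn) : wordEv [a] = a.ev := by simp [wordEv]
lemma wordEv_two (a b : Gn) : wordEv [a, b] = a.ev * b.ev := by simp [wordEv]
lemma wordEv_three (a b c : Gn) : wordEv [a, b, c] = a.ev * b.ev * c.ev := by
  simp [wordEv, mul_assoc]

lemma RE_ev (β : ℂ) (hβ : β ^ 4 = -1) (t : Nat) (ht : β ^ t = Complex.I) :
    Ex2.ev β (RE t) = (2:ℂ) • Rmat β := by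
  simp only [Ex2.ev, RE, Ex.ev, ct_ev, wordEv_nil, wordEv_one, wordEv_two, wordEv_three, Gn.ev,
    sc_o, sc_m β hβ, sc_i β t ht, sc_ni β hβ t ht, sc_q β t ht, sc_r β hβ t ht,
    sc_nr β hβ t ht, sc_nq β hβ t ht, sc_d β t ht, sc_nd β hβ t ht, sc_b, sc_nib β hβ t ht, sc_two,
    sc_four, sc_fi β t ht, Rmat, R00, R01, R10,
    R11, eEF, eEK, eFK, eEFK, one_smul, neg_smul, ← sub_eq_add_neg,
    smul_add, smul_mul_assoc, smul_smul, mul_smul_comm, mul_assoc]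
  norm_num
  simp only [sub_smul]
  ring_nf
  try abel

open Gn in
/-- The ribbon element. -/
def vE (t : Nat) : Ex1 :=
  ((cw [0] [e0]).add (cw [5 + t] [K, e1])).mul
    ((cw [0] []).add (cw [t, t] [F, E, Ki]))

lemma vE_ev (β : ℂ) (hβ : β ^ 4 = -1) (t : Nat) (ht : β ^ t = Complex.I) :
    Ex1.ev β (vE t) = vRib β := by
  simp only [Ex1.ev, vE, Ex.ev, cw_ev, wordEv_nil, wordEv_one, wordEv_two, wordEv_three, Gn.ev,
    sc_o, sc_m β hβ, sc_i β t ht, sc_ni β hβ t ht, sc_q β t ht, sc_r β hβ t ht,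
    sc_nr β hβ t ht, sc_nq β hβ t ht, sc_d β t ht, sc_nd β hβ t ht, sc_b, sc_nib β hβ t ht, sc_two,
    sc_four, sc_fi β t ht, vRib, fp, fm,
    smul_mul_assoc, mul_assoc]
  congr 1 <;> module

open Gn in
/-- `2 Δ(v)`. -/
def DvE (t : Nat) : Ex2 :=
  (((ct [0] [] []).add (ct [0] [K, K] [K, K])).add
    ((ct [5 + t] [K] [K]).mul ((ct [0] [] []).add (ct [4] [K, K] [K, K])))).mul
    ((ct [0] [] []).add (.s [t, t]
      (((ct [0] [Ki] [F]).add (ct [0] [F] [])).mul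
        (((ct [0] [] [E]).add (ct [0] [E] [K])).mul (ct [0] [Ki] [Ki])))))

lemma DvE_ev (β : ℂ) (hβ : β ^ 4 = -1) (t : Nat) (ht : β ^ t = Complex.I)
    (Δ : Q →ₐ[ℂ] TP2 ℂ Q)
    (hΔE : Δ gE = (1:Q) ⊗ₜ[ℂ] gE + gE ⊗ₜ[ℂ] gK)
    (hΔF : Δ gF = gKi ⊗ₜ[ℂ] gF + gF ⊗ₜ[ℂ] (1:Q))
    (hΔK : Δ gK = gK ⊗ₜ[ℂ] gK) : Ex2.ev β (DvE t) = (2:ℂ) • Δ (vRib β) := by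
  have hKi : Δ gKi = gKi ⊗ₜ[ℂ] gKi := by
    rw [rel_Ki, map_pow, hΔK, Algebra.TensorProduct.tmul_pow]
  have hK2 : Δ (gK ^ 2) = (gK * gK) ⊗ₜ[ℂ] (gK * gK) := by
    rw [pow_two, map_mul, hΔK, Algebra.TensorProduct.tmul_mul_tmul]
  simp only [Ex2.ev, DvE, Ex.ev, ct_ev, wordEv_nil, wordEv_one, wordEv_two, Gn.ev,
    sc_o, sc_m β hβ, sc_i β t ht, sc_ni β hβ t ht, sc_q β t ht, sc_r β hβ t ht,
    sc_nr β hβ t ht, sc_nq β hβ t ht, sc_d β t ht, sc_nd β hβ t ht, sc_b, sc_nib β hβ t ht, sc_two,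
    sc_four, sc_fi β t ht, vRib, fp, fm, e0, e1,
    map_mul, map_sub, map_add, map_smul, map_one, hK2, hKi, hΔE, hΔF,
    hΔK, one_smul, t2]
  rw [← smul_mul_assoc (2:ℂ)]
  rw [Algebra.TensorProduct.one_def]
  refine congrArg₂ (fun a b : TP2 ℂ Q => a * b) ?_ ?_
  · simp only [mul_smul_comm, smul_mul_assoc, mul_sub, mul_add]
    module
  · simp only [mul_smul_comm, smul_mul_assoc]
    module

lemma ribbon_check : ∀ t ∈ [2, 6], ∀ x ∈ ctxs t, ∀ y ∈ ctxs t,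
    weqv (Ex2.act x y ((RE t).swap.mul ((RE t).mul (DvE t))) wp)
      (Ex2.act x y (.s [0, 0, 0, 0, 0, 0, 0, 0] (((vE t).lift (fun l => (l, []))).mul
      ((vE t).lift (fun l => ([], l))))) wp) = true := by
  decide +kernel

lemma smul_cancel {M : Type} [AddCommGroup M] [Module ℂ M] (c : ℂ) (hc : c ≠ 0) {a b : M}
    (h : c • a = c • b) : a = b := smul_right_injective M hc h

lemma ribbon_abs {β : ℂ} (hβ : β ^ 4 = -1) (t : Nat) (ht : β ^ t = Complex.I) (r d : Ex2) (v : Ex1)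
    (h : ∀ x ∈ ctxs t, ∀ y ∈ ctxs t, weqv (Ex2.act x y (r.swap.mul (r.mul d)) wp)
      (Ex2.act x y (.s [0, 0, 0, 0, 0, 0, 0, 0] ((v.lift (fun l => (l, []))).mul
      (v.lift (fun l => ([], l))))) wp) = true) :
    flipA ℂ Q (Ex2.ev β r) * (Ex2.ev β r * Ex2.ev β d)
      = (8 : ℂ) • (Ex1.ev β v ⊗ₜ[ℂ] Ex1.ev β v) := by
  have h := check2 hβ t ht _ _ h
  have h1 : Ex2.ev β (r.swap.mul (r.mul d))
    = Ex2.ev β r.swap * (Ex2.ev β r * Ex2.ev β d) := rfl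
  have h2 : ∀ c a b, Ex2.ev β (.s c (.mul a b)) = scEv β c • (Ex2.ev β a * Ex2.ev β b) :=
    fun _ _ _ => rfl
  rw [h1, h2, swap_ev, lift_evL, lift_evR, sc_eight, Algebra.TensorProduct.tmul_mul_tmul, one_mul,
    mul_one] at h
  exact h

lemma ribA (β : ℂ) (hβ : β ^ 4 = -1) (t : Nat) (ht : β ^ t = Complex.I) (ht' : t ∈ [2, 6]) :
    flipA ℂ Q (Ex2.ev β (RE t)) * (Ex2.ev β (RE t) * Ex2.ev β (DvE t))
      = (8 : ℂ) • (Ex1.ev β (vE t) ⊗ₜ[ℂ] Ex1.ev β (vE t)) :=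
  ribbon_abs hβ t ht (RE t) (DvE t) (vE t) (ribbon_check t ht')

lemma scale_abs {A : Type} [Ring A] [Algebra ℂ A] (f : A →ₗ[ℂ] A) (r d w : A)
    (h : f ((2:ℂ) • r) * (((2:ℂ) • r) * (2:ℂ) • d) = (8 : ℂ) • w) : f r * r * d = w := by
  apply smul_cancel (8 : ℂ) (by norm_num)
  rw [← h]
  simp only [map_smul, smul_mul_assoc, mul_smul_comm, smul_smul, mul_assoc]
  norm_num

lemma scale_tp (a b m r d w : TP2 ℂ Q) (v v' : Q) (ha : a = (2:ℂ) • r) (hb : b = (2:ℂ) • d)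
    (hm : m = flipA ℂ Q r * r) (hv : v = v') (hw : w = v' ⊗ₜ[ℂ] v')
    (h : flipA ℂ Q a * (a * b) = (8 : ℂ) • (v ⊗ₜ[ℂ] v)) : m * d = w := by
  subst ha hb hm hv hw
  exact scale_abs (flipA ℂ Q) r d _ h

lemma Mmat_eq (β : ℂ) : Mmat β = flipA ℂ Q (Rmat β) * Rmat β := rfl

lemma ribbon_eq (β : ℂ) (hβ : β ^ 4 = -1) (t : Nat) (ht : β ^ t = Complex.I)
    (ht' : t ∈ [2, 6])
    (Δ : Q →ₐ[ℂ] TP2 ℂ Q)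
    (hΔE : Δ gE = (1:Q) ⊗ₜ[ℂ] gE + gE ⊗ₜ[ℂ] gK)
    (hΔF : Δ gF = gKi ⊗ₜ[ℂ] gF + gF ⊗ₜ[ℂ] (1:Q))
    (hΔK : Δ gK = gK ⊗ₜ[ℂ] gK) :
    Mmat β * Δ (vRib β) = vRib β ⊗ₜ[ℂ] vRib β := by
  exact scale_tp _ _ _ _ _ _ _ _ (RE_ev β hβ t ht) (DvE_ev β hβ t ht Δ hΔE hΔF hΔK) (Mmat_eq β)
    (vE_ev β hβ t ht) rfl (ribA β hβ t ht ht')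

/-! ### Single-factor checks -/

open Gn in
/-- The inverse of the ribbon element. -/
def uE (t : Nat) : Ex1 :=
  ((cw [0] [e0]).mul
    ((cw [0] []).add (cw [4 + t, 4 + t] [F, E, Ki]))).add
  ((cw [3 + t] [K, e1]).mul
    ((cw [0] []).add (cw [t, t] [F, E, Ki])))

lemma unit_check : ∀ t ∈ [2, 6], ∀ x ∈ ctxs t,
    veqv (Ex1.act x ((vE t).mul (uE t)) vp) (Ex1.act x (cw [0] []) vp) = true ∧
    veqv (Ex1.act x ((uE t).mul (vE t)) vp) (Ex1.act x (cw [0] []) vp) = true := by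
  decide +kernel

lemma central_check : ∀ t ∈ [2, 6], ∀ g ∈ [Gn.E, Gn.F, Gn.K, Gn.Ki], ∀ x ∈ ctxs t,
    veqv (Ex1.act x ((vE t).mul (.w [g])) vp) (Ex1.act x (Ex.mul (.w [g]) (vE t)) vp) = true := by
  decide +kernel

open Gn in
/-- `2 S(v)`. -/
def SE (t : Nat) : Ex1 :=
  ((cw [0] []).add (cw [t, t] [K, E, Ki, K, F])).mul
    (((cw [0] []).add (cw [0] [Ki, Ki])).add
      (.s [5 + t]
        (((cw [0] []).add (cw [4] [Ki, Ki])).mul (cw [0] [Ki]))))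

lemma S_check : ∀ t ∈ [2, 6], ∀ x ∈ ctxs t,
    veqv (Ex1.act x (SE t) vp) (Ex1.act x (.s [0, 0] (vE t)) vp) = true := by
  decide +kernel

open Gn in
/-- Twice the decomposition. -/
def dE (t : Nat) : Ex1 :=
  ((cw [0, 0] [e0]).add (.s [1] ((cw [0, 0, 0, 0] [F, E, e1]).add
    ((cw [4 + t] [K, e1]).add (cw [t] [Ki, e1]))))).add
    (cw [t, t, t, t] [E, F, K, e0])

lemma d_check : ∀ t ∈ [2, 6], ∀ x ∈ ctxs t,
    veqv (Ex1.act x (.s [0, 0] (vE t)) vp) (Ex1.act x (dE t) vp) = true := by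
  decide +kernel

lemma unit_eq (β : ℂ) (hβ : β ^ 4 = -1) (t : Nat) (ht : β ^ t = Complex.I)
    (ht' : t ∈ [2, 6]) : IsUnit (vRib β) := by
  have h1 := check1 hβ t ht _ _ (fun x hx => (unit_check t ht' x hx).1)
  have h2 := check1 hβ t ht _ _ (fun x hx => (unit_check t ht' x hx).2)
  have hv := vE_ev β hβ t ht
  simp only [Ex1.ev, Ex.ev, cw_ev, sc_o, wordEv_nil, one_smul] at h1 h2 hv
  rw [hv] at h1 h2
  exact ⟨⟨_, _, h1, h2⟩, rfl⟩

lemma central_gen (β : ℂ) (hβ : β ^ 4 = -1) (t : Nat) (ht : β ^ t = Complex.I)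
    (ht' : t ∈ [2, 6]) (g : Gn) (hg : g ∈ [Gn.E, Gn.F, Gn.K, Gn.Ki]) :
    vRib β * g.ev = g.ev * vRib β := by
  have h := check1 hβ t ht _ _ (central_check t ht' g hg)
  have hv := vE_ev β hβ t ht
  simp only [Ex1.ev, Ex.ev, wordEv_one] at h hv
  rwa [hv] at h

lemma central_eq (β : ℂ) (hβ : β ^ 4 = -1) (t : Nat) (ht : β ^ t = Complex.I)
    (ht' : t ∈ [2, 6]) (x : Q) : vRib β * x = x * vRib β := by
  obtain ⟨y, rfl⟩ := RingQuot.mkAlgHom_surjective ℂ QRel x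
  induction y using FreeAlgebra.induction with
  | grade0 r => rw [AlgHom.commutes]; exact (Algebra.commutes r _).symm
  | grade1 g =>
    cases g
    · exact central_gen β hβ t ht ht' Gn.E (by simp)
    · exact central_gen β hβ t ht ht' Gn.F (by simp)
    · exact central_gen β hβ t ht ht' Gn.K (by simp)
    · exact central_gen β hβ t ht ht' Gn.Ki (by simp)
  | mul a b ha hb => rw [map_mul, ← mul_assoc, ha, mul_assoc, hb, mul_assoc]
  | add a b ha hb => rw [map_add, mul_add, add_mul, ha, hb]

lemma S_eq (β : ℂ) (hβ : β ^ 4 = -1) (t : Nat) (ht : β ^ t = Complex.I)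
    (ht' : t ∈ [2, 6])
    (S : Q →ₗ[ℂ] Q) (hS1 : S 1 = 1) (hSmul : ∀ a b : Q, S (a * b) = S b * S a)
    (hSE : S gE = -(gE * gKi)) (hSF : S gF = -(gK * gF)) (hSK : S gK = gKi) :
    S (vRib β) = vRib β := by
  have h := check1 hβ t ht _ _ (S_check t ht')
  have hv := vE_ev β hβ t ht
  have hSKi : S gKi = gK := by
    have h1 : S gKi * gKi = 1 := by
      have h2 := hSmul gK gKi
      rw [rel_KKi, hS1, hSK] at h2
      exact h2.symm
    calc S gKi = S gKi * (gKi * gK) := by rw [rel_KiK, mul_one]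
      _ = _ := by rw [← mul_assoc, h1, one_mul]
  rw [q_neg] at hSE hSF
  have hw : wordEv [Gn.K, Gn.E, Gn.Ki, Gn.K, Gn.F] = gK * (gE * (gKi * (gK * gF))) := by
    simp [wordEv, Gn.ev]
  simp only [Ex1.ev, Ex.ev, SE, cw_ev, sc_o, sc_m β hβ, sc_i β t ht, sc_ni β hβ t ht, sc_q β t ht, sc_r β hβ t ht,
    sc_nr β hβ t ht, sc_nq β hβ t ht, sc_d β t ht, sc_nd β hβ t ht, sc_b, sc_nib β hβ t ht, sc_two,
    sc_four, sc_fi β t ht,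
    wordEv_nil, wordEv_one, wordEv_two, hw, Gn.ev, one_smul] at h hv
  rw [hv] at h
  apply smul_cancel (2 : ℂ) (by norm_num)
  rw [← h]
  simp only [vRib, e0, e1, fp, fm, hSmul, map_sub, map_add, map_smul, hS1, hSE, hSF, hSK, hSKi,
    pow_two]
  rw [← mul_smul_comm]
  congr 1
  · simp only [mul_smul_comm, smul_mul_assoc, mul_assoc]
    module
  · simp only [smul_mul_assoc, sub_mul, add_mul]
    push_cast
    module

lemma dec_eq (β : ℂ) (hβ : β ^ 4 = -1) (t : Nat) (ht : β ^ t = Complex.I)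
    (ht' : t ∈ [2, 6]) :
    vRib β = e0 + β • ((((2:ℂ)⁻¹ • (1:Q) + Cas) * e1) - (((2:ℂ)⁻¹ • (1:Q) - Cas) * e1))
      + (2 * Complex.I) •
        ((2:ℂ)⁻¹ • (gE * gF * (1 + gK) * e0) - (2:ℂ)⁻¹ • (gE * gF * (1 - gK) * e0)) := by
  have h := check1 hβ t ht _ _ (d_check t ht')
  have hv := vE_ev β hβ t ht
  have hw : wordEv [Gn.E, Gn.F, Gn.K, Gn.e0] = gE * (gF * (gK * e0)) := by
    simp [wordEv, Gn.ev]
  simp only [Ex1.ev, Ex.ev, dE, cw_ev, sc_o, sc_m β hβ, sc_i β t ht, sc_ni β hβ t ht, sc_q β t ht, sc_r β hβ t ht,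
    sc_nr β hβ t ht, sc_nq β hβ t ht, sc_d β t ht, sc_nd β hβ t ht, sc_b, sc_nib β hβ t ht, sc_two,
    sc_four, sc_fi β t ht,
    wordEv_nil, wordEv_one, wordEv_two, wordEv_three, hw, Gn.ev, one_smul] at h hv
  rw [hv] at h
  apply smul_cancel (2 : ℂ) (by norm_num)
  rw [h]
  simp only [Cas, add_mul, sub_mul, mul_add, mul_sub, smul_mul_assoc, one_mul, mul_one, mul_assoc]
  module

lemma ce_eq (β : ℂ) (ce : Q →ₐ[ℂ] ℂ) (hceE : ce gE = 0) (hceK : ce gK = 1) :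
    ce (vRib β) = 1 := by
  simp only [vRib, e0, e1, fp, fm, map_mul, map_sub, map_add, map_smul, map_one, map_pow, hceE,
    hceK]
  norm_num


/-- `v = (e₀ − iβ K e₁)(1 − 2 f⁺f⁻)` is a ribbon element for the
quasi-triangular quasi-Hopf algebra `(Q, Φ, R)`: it is central, invertible, has
counit 1, is fixed by the antipode, satisfies `M·Δ(v) = v⊗v`, and decomposes over
the central (nilpotent and idempotent) basis. -/
theorem statement15 (β : ℂ) (hβ : β ^ 4 = -1)
    (Δ : Q →ₐ[ℂ] TP2 ℂ Q)
    (hΔE : Δ gE = (1:Q) ⊗ₜ[ℂ] gE + gE ⊗ₜ[ℂ] gK)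
    (hΔF : Δ gF = gKi ⊗ₜ[ℂ] gF + gF ⊗ₜ[ℂ] (1:Q))
    (hΔK : Δ gK = gK ⊗ₜ[ℂ] gK)
    (ce : Q →ₐ[ℂ] ℂ) (hceE : ce gE = 0) (hceF : ce gF = 0) (hceK : ce gK = 1)
    (S : Q →ₗ[ℂ] Q) (hS1 : S 1 = 1) (hSmul : ∀ a b : Q, S (a * b) = S b * S a)
    (hSE : S gE = -(gE * gKi)) (hSF : S gF = -(gK * gF)) (hSK : S gK = gKi) :
    (∀ x : Q, vRib β * x = x * vRib β) ∧
    IsUnit (vRib β) ∧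
    ce (vRib β) = 1 ∧
    S (vRib β) = vRib β ∧
    Mmat β * Δ (vRib β) = vRib β ⊗ₜ[ℂ] vRib β ∧
    vRib β = e0 + β • ((((2:ℂ)⁻¹ • (1:Q) + Cas) * e1) - (((2:ℂ)⁻¹ • (1:Q) - Cas) * e1))
      + (2 * Complex.I) •
        ((2:ℂ)⁻¹ • (gE * gF * (1 + gK) * e0) - (2:ℂ)⁻¹ • (gE * gF * (1 - gK) * e0)) := by
  obtain ⟨t, ht', ht⟩ : ∃ t ∈ [2, 6], β ^ t = Complex.I := by
    have h : (Complex.I - β ^ 2) * (Complex.I + β ^ 2) = 0 := by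
      linear_combination Complex.I_sq - hβ
    rcases mul_eq_zero.mp h with h | h
    · exact ⟨2, by simp, by linear_combination -h⟩
    · exact ⟨6, by simp, by linear_combination β ^ 2 * hβ - h⟩
  exact ⟨central_eq β hβ t ht ht', unit_eq β hβ t ht ht', ce_eq β ce hceE hceK,
    S_eq β hβ t ht ht' S hS1 hSmul hSE hSF hSK,
    ribbon_eq β hβ t ht ht' Δ hΔE hΔF hΔK, dec_eq β hβ t ht ht'⟩
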